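/- Let (X,c) and (Y,d) be closure spaces and ζ ⊆ X × Y a relation. The following statements are equivalent: (i) ζ : (X,c) ⇸ (Y,d) is continuous; (ii) c(ζ*(d B)) = c(ζ*(B)) for all B ⊆ Y; (iii) d(ζ_*(c A)) = ζ_*(c A) for all A ⊆ X; (iv) ζ_*(A) is closed in (Y,d) whenever A is closed in (X,c). -/

import Mathlib

/-- The inverse-image operator `ζ*` of a relation `ζ ⊆ X × Y`. -/
def relStar {X Y : Type*} (ζ : Set (X × Y)) (B : Set Y) : Set X :=
  {x : X | ∃ y ∈ B, (x, y) ∈ ζ}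

/-- The right adjoint `ζ_*` of `ζ*` for a relation `ζ ⊆ X × Y`. -/
def relLower {X Y : Type*} (ζ : Set (X × Y)) (A : Set X) : Set Y :=
  {y : Y | ∀ x : X, (x, y) ∈ ζ → x ∈ A}

theorem relStar_subset_iff {X Y : Type*} {ζ : Set (X × Y)} {A : Set X} {B : Set Y} :
    relStar ζ B ⊆ A ↔ B ⊆ relLower ζ A :=
  ⟨fun h y hy _ hx => h ⟨y, hy, hx⟩, fun h x ⟨_, hy, hx⟩ => h hy x hx⟩

theorem relStar_mono {X Y : Type*} (ζ : Set (X × Y)) {B B' : Set Y} (h : B ⊆ B') :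
    relStar ζ B ⊆ relStar ζ B' :=
  fun _ ⟨y, hy, hx⟩ => ⟨y, h hy, hx⟩

/-- Characterizations of continuous relations between closure
spaces. -/
theorem continuous_relation_tfae {X Y : Type*}
    (c : Set X → Set X) (d : Set Y → Set Y)
    (hcmono : ∀ A B : Set X, A ⊆ B → c A ⊆ c B)
    (hcext : ∀ A : Set X, A ⊆ c A)
    (hcidem : ∀ A : Set X, c (c A) = c A)
    (hdmono : ∀ A B : Set Y, A ⊆ B → d A ⊆ d B)
    (hdext : ∀ A : Set Y, A ⊆ d A)
    (hdidem : ∀ A : Set Y, d (d A) = d A)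
    (ζ : Set (X × Y)) :
    [ ∀ B : Set Y, relStar ζ (d B) ⊆ c (relStar ζ B),
      ∀ B : Set Y, c (relStar ζ (d B)) = c (relStar ζ B),
      ∀ A : Set X, d (relLower ζ (c A)) = relLower ζ (c A),
      ∀ A : Set X, c A = A → d (relLower ζ A) = relLower ζ A ].TFAE := by
  tfae_have 1 → 2 := fun h B =>
    ((hcmono _ _ (h B)).trans_eq (hcidem _)).antisymm (hcmono _ _ (relStar_mono ζ (hdext B)))
  tfae_have 2 → 1 := fun h B => (hcext _).trans_eq (h B)
  tfae_have 1 → 4 := fun h A hA =>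
    (relStar_subset_iff.1 <| (h _).trans <|
      (hcmono _ _ (relStar_subset_iff.2 subset_rfl)).trans_eq hA).antisymm (hdext _)
  tfae_have 4 → 3 := fun h A => h _ (hcidem A)
  tfae_have 3 → 1 := fun h B => relStar_subset_iff.2 <|
    (hdmono _ _ (relStar_subset_iff.1 (hcext _))).trans_eq (h _)
  tfae_finish
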